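/- For i ∈ V_{n-1}, 1 ≤ r ≤ n−3, and ε ∈ {0,1}^r, one has p_ε(i) ≡ 2 (mod 2^n) if and only if i ≡ 1 (mod 2^{n-r}) and ε = (0, 1, 1, …, 1) (i.e., ε_0 = 0 and ε_j = 1 for 1 ≤ j ≤ r−1). -/

import Mathlib

/-- The representative of `x` modulo `2^n` taken in `{1, …, 2^n}`. -/
def vmod (n : ℕ) (x : ℤ) : ℤ := (x - 1) % (2 ^ n) + 1

/-- The maps `p₀(i) = 2i mod 2^n` and `p₁(i) = 2i - 1 mod 2^n`; `j = true` codes `p₁`. -/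
def pmap (n : ℕ) (j : Bool) (i : ℤ) : ℤ :=
  if j then vmod n (2 * i - 1) else vmod n (2 * i)

/-- Composition `p_{ε₀} ∘ ⋯ ∘ p_{ε_{r-1}}` along a list `ε` of bits. -/
def pcomp (n : ℕ) : List Bool → ℤ → ℤ
  | [], i => i
  | e :: es, i => pmap n e (pcomp n es i)

theorem vmod_modEq (n : ℕ) (x : ℤ) : vmod n x ≡ x [ZMOD 2 ^ n] := by
  simpa [vmod] using (Int.mod_modEq (x - 1) (2 ^ n)).add_right 1

theorem pmap_modEq (n : ℕ) (e : Bool) (i : ℤ) :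
    pmap n e i ≡ 2 * i - (if e then 1 else 0) [ZMOD 2 ^ n] := by
  cases e <;> simpa [pmap] using vmod_modEq n _

theorem pmap_modEq_one_iff {n k : ℕ} (hk : k + 1 ≤ n) (e : Bool) (x : ℤ) :
    pmap n e x ≡ 1 [ZMOD 2 ^ (k + 1)] ↔ x ≡ 1 [ZMOD 2 ^ k] ∧ e = true := by
  have h : pmap n e x ≡ 2 * x - (if e then 1 else 0) [ZMOD 2 ^ (k + 1)] :=
    (pmap_modEq n e x).of_dvd (pow_dvd_pow 2 hk)
  rw [show pmap n e x ≡ 1 [ZMOD 2 ^ (k + 1)] ↔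
    2 * x - (if e then 1 else 0) ≡ 1 [ZMOD 2 ^ (k + 1)] from ⟨h.symm.trans, h.trans⟩]
  simp only [Int.modEq_iff_dvd, pow_succ']
  cases e
  · simp only [Bool.false_eq_true, if_false, and_false, iff_false]
    intro hd
    have := dvd_of_mul_right_dvd hd
    omega
  · rw [if_pos rfl, show 1 - (2 * x - 1) = 2 * (1 - x) by ring,
      mul_dvd_mul_iff_left two_ne_zero]
    simp

theorem pmap_modEq_two_iff {n k : ℕ} (hk : k + 1 ≤ n) (e : Bool) (x : ℤ) :
    pmap n e x ≡ 2 [ZMOD 2 ^ (k + 1)] ↔ x ≡ 1 [ZMOD 2 ^ k] ∧ e = false := by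
  have h : pmap n e x ≡ 2 * x - (if e then 1 else 0) [ZMOD 2 ^ (k + 1)] :=
    (pmap_modEq n e x).of_dvd (pow_dvd_pow 2 hk)
  rw [show pmap n e x ≡ 2 [ZMOD 2 ^ (k + 1)] ↔
    2 * x - (if e then 1 else 0) ≡ 2 [ZMOD 2 ^ (k + 1)] from ⟨h.symm.trans, h.trans⟩]
  simp only [Int.modEq_iff_dvd, pow_succ']
  cases e
  · rw [if_neg Bool.false_ne_true, show 2 - (2 * x - 0) = 2 * (1 - x) by ring,
      mul_dvd_mul_iff_left two_ne_zero]
    simp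
  · simp only [if_true, Bool.true_eq_false, and_false, iff_false]
    intro hd
    have := dvd_of_mul_right_dvd hd
    omega

theorem pcomp_modEq_one_iff {n k : ℕ} (l : List Bool) (hk : k + l.length ≤ n) (i : ℤ) :
    pcomp n l i ≡ 1 [ZMOD 2 ^ (k + l.length)] ↔
      i ≡ 1 [ZMOD 2 ^ k] ∧ ∀ e ∈ l, e = true := by
  induction l with
  | nil => simp [pcomp]
  | cons e l ih =>
    rw [List.length_cons, ← add_assoc] at hk ⊢
    rw [pcomp, pmap_modEq_one_iff hk, ih (by omega), List.forall_mem_cons]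
    tauto

theorem stmt2 (n r : ℕ) (hn : 4 ≤ n) (hr1 : 1 ≤ r) (hr2 : r ≤ n - 3)
    (ε : Fin r → Bool) (i : ℤ) (hi1 : 1 ≤ i) (hi2 : i ≤ 2 ^ (n - 1)) :
    pcomp n (List.ofFn ε) i ≡ 2 [ZMOD (2 ^ n)] ↔
      (i ≡ 1 [ZMOD (2 ^ (n - r))] ∧ ∀ j : Fin r, (ε j = true ↔ (j : ℕ) ≠ 0)) := by
  obtain ⟨s, rfl⟩ := Nat.exists_eq_add_of_le' hr1
  obtain ⟨k, rfl⟩ := Nat.exists_eq_add_of_le' (show s + 1 ≤ n by omega)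
  have h := pcomp_modEq_one_iff (n := k + (s + 1)) (k := k)
    (List.ofFn fun j : Fin s => ε j.succ) (by simp) i
  rw [List.length_ofFn] at h
  rw [List.ofFn_succ, pcomp, ← add_assoc, pmap_modEq_two_iff le_rfl, add_assoc, h,
    Nat.add_sub_cancel, Fin.forall_fin_succ]
  simp
  tauto
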